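/- For every fixed D > 0 there exists a constant C_D > 0, independent of the dimension d ∈ ℤ_+, such that for all d ∈ ℤ_+, all ξ ∈ 𝕋^d and all t with 0 < t ≤ D one has | F_{ℤ^d} g_t(ξ) − 1 | ≤ C_D e^{-π/t} |ξ|². -/

import Mathlib

open scoped ENNReal Real BigOperators
open Real

/-- The one-dimensional Theta function `θ_t(ζ) = Σ_{k∈ℤ} exp(-π(k-ζ)²t)`. -/
noncomputable def theta (t ζ : ℝ) : ℝ :=
  ∑' k : ℤ, Real.exp (-π * ((k : ℝ) - ζ) ^ 2 * t)

/-- The d-dimensional Theta function `Θ_t(ξ) = Π_j θ_t(ξ_j)`. -/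
noncomputable def bigTheta (d : ℕ) (t : ℝ) (ξ : Fin d → ℝ) : ℝ :=
  ∏ j, theta t (ξ j)

/-- The discrete normalized Gaussian kernel `g_t(n) = Θ_{1/t}(0)⁻¹ exp(-π|n|²/t)`. -/
noncomputable def gauss (d : ℕ) (t : ℝ) (n : Fin d → ℤ) : ℝ :=
  (bigTheta d (1 / t) 0)⁻¹ * Real.exp (-π * (∑ j, ((n j : ℝ)) ^ 2) / t)

/-- The convolution operator `G_t f(x) = Σ_n g_t(n) f(x-n)` on ℤ^d. -/
noncomputable def gConv (d : ℕ) (t : ℝ) (f : (Fin d → ℤ) → ℂ) (x : Fin d → ℤ) : ℂ :=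
  ∑' n : Fin d → ℤ, (gauss d t n : ℂ) * f (x - n)

/-- The ℓ^p norm (valued in ℝ≥0∞) of an ℝ≥0∞-valued function on ℤ^d. -/
noncomputable def lpNorm (d : ℕ) (p : ℝ) (F : (Fin d → ℤ) → ℝ≥0∞) : ℝ≥0∞ :=
  (∑' x : Fin d → ℤ, F x ^ p) ^ (1 / p)

/-- The Fourier transform of the discrete Gaussian kernel,
`F_{ℤ^d} g_t(ξ) = Σ_{n∈ℤ^d} g_t(n) e^{2πi n·ξ}`. -/
noncomputable def fourierGauss (d : ℕ) (t : ℝ) (ξ : Fin d → ℝ) : ℂ :=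
  ∑' n : Fin d → ℤ, (gauss d t n : ℂ) *
    Complex.exp (2 * (π : ℂ) * Complex.I * ∑ j, (n j : ℂ) * (ξ j : ℂ))


lemma fg_prod_tsum : ∀ (d : ℕ) (f : Fin d → ℤ → ℂ), (∀ j, Summable fun k => ‖f j k‖) →
    (Summable fun n : Fin d → ℤ => ‖∏ j, f j (n j)‖) ∧
      ∑' n : Fin d → ℤ, ∏ j, f j (n j) = ∏ j, ∑' k, f j k
  | 0, f, _ => by
    refine ⟨(hasSum_fintype _).summable, ?_⟩
    simp
  | d + 1, f, hf => by
    obtain ⟨h1, h2⟩ := fg_prod_tsum d (fun j => f j.succ) (fun j => hf j.succ)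
    have h3 := Summable.mul_norm (hf 0) h1
    have h4 := tsum_mul_tsum_of_summable_norm (hf 0) h1
    let e : ℤ × (Fin d → ℤ) ≃ (Fin (d + 1) → ℤ) := Fin.consEquiv (fun _ => ℤ)
    have he : ∀ p : ℤ × (Fin d → ℤ), ∏ j, f j (e p j) = f 0 p.1 * ∏ j : Fin d, f j.succ (p.2 j) := by
      intro p
      rw [Fin.prod_univ_succ]
      simp [e, Fin.consEquiv]
    constructor
    · rw [← e.summable_iff]
      refine h3.congr ?_
      intro p
      simp only [Function.comp, he]
    · rw [← e.tsum_eq, Fin.prod_univ_succ, ← h2, h4]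
      exact tsum_congr he

lemma fg_summable_sq {T : ℝ} (hT : 0 < T) (m : ℕ) :
    Summable (fun n : ℤ ↦ (|n| ^ m : ℝ) * Real.exp (-π * (n : ℝ) ^ 2 / T)) := by
  have := summable_pow_mul_jacobiTheta₂_term_bound 0 (T := 1 / T) (by positivity) m
  refine this.congr ?_
  intro n
  congr 2
  ring

lemma fg_norm_exp (k : ℤ) (x : ℝ) :
    ‖Complex.exp (2 * (π : ℂ) * Complex.I * ((k : ℂ) * (x : ℂ)))‖ = 1 := by
  have : 2 * (π : ℂ) * Complex.I * ((k : ℂ) * (x : ℂ)) = ((2 * π * (k * x) : ℝ) : ℂ) * Complex.I := by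
    push_cast; ring
  rw [this, Complex.norm_exp_ofReal_mul_I]

noncomputable def fgTerm (t x : ℝ) (k : ℤ) : ℂ :=
  (Real.exp (-π * (k : ℝ) ^ 2 / t) : ℂ) *
    Complex.exp (2 * (π : ℂ) * Complex.I * ((k : ℂ) * (x : ℂ)))

lemma fg_norm_term (t x : ℝ) (k : ℤ) : ‖fgTerm t x k‖ = Real.exp (-π * (k : ℝ) ^ 2 / t) := by
  rw [fgTerm, norm_mul, fg_norm_exp, mul_one, Complex.norm_real, Real.norm_eq_abs, abs_of_pos (exp_pos _)]

lemma fg_summable_E {t : ℝ} (ht : 0 < t) : Summable fun k : ℤ => Real.exp (-π * (k : ℝ) ^ 2 / t) := by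
  simpa using fg_summable_sq ht 0

lemma fg_summable_term {t : ℝ} (ht : 0 < t) (x : ℝ) : Summable fun k => ‖fgTerm t x k‖ := by
  simpa only [fg_norm_term] using fg_summable_E ht

lemma fg_theta (t : ℝ) : theta (1 / t) 0 = ∑' k : ℤ, Real.exp (-π * (k : ℝ) ^ 2 / t) := by
  unfold theta
  refine tsum_congr fun k => ?_
  congr 1
  ring

lemma fg_one_le {t : ℝ} (ht : 0 < t) : 1 ≤ theta (1 / t) 0 := by
  rw [fg_theta]
  have := (fg_summable_E ht).le_tsum 0 (fun k _ => (exp_pos _).le)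
  simpa using this

lemma fg_norm_sum {t : ℝ} (ht : 0 < t) (x : ℝ) : ‖∑' k, fgTerm t x k‖ ≤ theta (1 / t) 0 := by
  rw [fg_theta]
  refine (norm_tsum_le_tsum_norm (fg_summable_term ht x)).trans ?_
  simp only [fg_norm_term]; exact le_rfl

lemma fg_pair (t x : ℝ) (k : ℤ) :
    ‖fgTerm t x k + fgTerm t x (-k) - 2 * (Real.exp (-π * (k : ℝ) ^ 2 / t) : ℂ)‖ ≤
      Real.exp (-π * (k : ℝ) ^ 2 / t) * (2 * π * k * x) ^ 2 := by
  have h : fgTerm t x k + fgTerm t x (-k) - 2 * (Real.exp (-π * (k : ℝ) ^ 2 / t) : ℂ) =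
      ((Real.exp (-π * (k : ℝ) ^ 2 / t) * (2 * Real.cos (2 * π * k * x) - 2) : ℝ) : ℂ) := by
    unfold fgTerm
    rw [show 2 * (π : ℂ) * Complex.I * ((k : ℂ) * (x : ℂ)) = (2 * π * k * x) * Complex.I by ring,
      show 2 * (π : ℂ) * Complex.I * (((-k : ℤ) : ℂ) * (x : ℂ)) = -(2 * π * k * x) * Complex.I by
        push_cast; ring]
    rw [show (((-k : ℤ) : ℝ)) ^ 2 = (k : ℝ) ^ 2 by push_cast; ring]
    push_cast
    rw [Complex.two_cos]
    ring
  rw [h, Complex.norm_real, Real.norm_eq_abs, abs_mul, abs_of_pos (exp_pos _)]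
  gcongr
  rw [abs_le]
  have := Real.one_sub_sq_div_two_le_cos (x := 2 * π * k * x)
  have := Real.cos_le_one (2 * π * k * x)
  constructor <;> nlinarith [sq_nonneg (2 * π * k * x)]

lemma fg_coef {D t : ℝ} (ht : 0 < t) (htD : t ≤ D) (k : ℤ) :
    (|k| ^ 2 : ℝ) * Real.exp (-π * (k : ℝ) ^ 2 / t) ≤
      Real.exp (-π / t) * Real.exp (π / D) * ((|k| ^ 2 : ℝ) * Real.exp (-π * (k : ℝ) ^ 2 / D)) := by
  rcases eq_or_ne k 0 with rfl | hk
  · simp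
  have hk1 : (1 : ℝ) ≤ (k : ℝ) ^ 2 := by
    have : 0 < k ^ 2 := by positivity
    exact_mod_cast this
  rw [mul_left_comm, ← Real.exp_add, ← Real.exp_add]
  gcongr
  have h : π * ((k : ℝ) ^ 2 - 1) / D ≤ π * ((k : ℝ) ^ 2 - 1) / t := by
    have : 0 ≤ π * ((k : ℝ) ^ 2 - 1) := mul_nonneg pi_pos.le (by linarith)
    gcongr
  have e1 : -π * (k : ℝ) ^ 2 / t = -π / t - π * ((k : ℝ) ^ 2 - 1) / t := by ring
  have e2 : -π / t + π / D + -π * (k : ℝ) ^ 2 / D = -π / t - π * ((k : ℝ) ^ 2 - 1) / D := by ring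
  rw [e1, e2]
  linarith

noncomputable def fgK (D : ℝ) : ℝ :=
  2 * π ^ 2 * Real.exp (π / D) * ∑' k : ℤ, (|k| ^ 2 : ℝ) * Real.exp (-π * (k : ℝ) ^ 2 / D)

lemma fg_sub {D t : ℝ} (ht : 0 < t) (htD : t ≤ D) (x : ℝ) :
    ‖∑' k, fgTerm t x k - (theta (1 / t) 0 : ℂ)‖ ≤ fgK D * Real.exp (-π / t) * x ^ 2 := by
  have hs := (fg_summable_term ht x).of_norm
  have hs' : Summable fun k => fgTerm t x (-k) := (Equiv.neg ℤ).summable_iff.2 hs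
  have hneg : ∑' k, fgTerm t x (-k) = ∑' k, fgTerm t x k := (Equiv.neg ℤ).tsum_eq (fgTerm t x)
  have hE : Summable fun k : ℤ => (Real.exp (-π * (k : ℝ) ^ 2 / t) : ℂ) :=
    Complex.ofRealCLM.summable (fg_summable_E ht)
  have h2 : (2 : ℂ) * (∑' k, fgTerm t x k - (theta (1 / t) 0 : ℂ)) =
      ∑' k : ℤ, (fgTerm t x k + fgTerm t x (-k) - 2 * (Real.exp (-π * (k : ℝ) ^ 2 / t) : ℂ)) := by
    rw [(hs.add hs').tsum_sub (hE.mul_left 2), hs.tsum_add hs', hneg, tsum_mul_left, fg_theta,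
      Complex.ofReal_tsum]
    ring
  have hD : 0 < D := ht.trans_le htD
  have hb : HasSum (fun k : ℤ => (4 * π ^ 2 * x ^ 2 * (Real.exp (-π / t) * Real.exp (π / D))) *
      ((|k| ^ 2 : ℝ) * Real.exp (-π * (k : ℝ) ^ 2 / D))) (2 * (fgK D * Real.exp (-π / t) * x ^ 2)) := by
    have h := (fg_summable_sq hD 2).hasSum.mul_left
      (4 * π ^ 2 * x ^ 2 * (Real.exp (-π / t) * Real.exp (π / D)))
    have e : 2 * (fgK D * Real.exp (-π / t) * x ^ 2) =
        (4 * π ^ 2 * x ^ 2 * (Real.exp (-π / t) * Real.exp (π / D))) *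
          ∑' k : ℤ, (|k| ^ 2 : ℝ) * Real.exp (-π * (k : ℝ) ^ 2 / D) := by
      unfold fgK
      ring
    rw [e]
    exact h
  have h3 := tsum_of_norm_bounded (f := fun k : ℤ =>
    (fgTerm t x k + fgTerm t x (-k) - 2 * (Real.exp (-π * (k : ℝ) ^ 2 / t) : ℂ))) hb (by
      intro k
      refine (fg_pair t x k).trans ?_
      have := mul_le_mul_of_nonneg_left (fg_coef ht htD k) (show 0 ≤ 4 * π ^ 2 * x ^ 2 by positivity)
      have hk : ((|k| : ℤ) : ℝ) ^ 2 = (k : ℝ) ^ 2 := by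
        rw [Int.cast_abs, sq_abs]
      rw [hk] at this ⊢
      linarith)
  rw [← h2, norm_mul] at h3
  simp only [Complex.norm_ofNat] at h3
  linarith

lemma fg_prod_sub {ι : Type*} (s : Finset ι) (z : ι → ℂ) (hz : ∀ i, ‖z i‖ ≤ 1) :
    ‖∏ i ∈ s, z i - 1‖ ≤ ∑ i ∈ s, ‖z i - 1‖ := by
  classical
  induction s using Finset.induction_on with
  | empty => simp
  | insert a s ha ih =>
    rw [Finset.prod_insert ha, Finset.sum_insert ha,
      show z a * ∏ i ∈ s, z i - 1 = (z a - 1) + z a * (∏ i ∈ s, z i - 1) by ring]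
    refine (norm_add_le _ _).trans ?_
    rw [norm_mul]
    have := mul_le_mul (hz a) ih (norm_nonneg _) zero_le_one
    linarith

lemma fg_eq (d : ℕ) {t : ℝ} (ht : 0 < t) (ξ : Fin d → ℝ) :
    fourierGauss d t ξ = ∏ j, (∑' k, fgTerm t (ξ j) k) / (theta (1 / t) 0 : ℂ) := by
  have h := (fg_prod_tsum d (fun j => fgTerm t (ξ j)) (fun j => fg_summable_term ht (ξ j))).2
  rw [Finset.prod_div_distrib, ← h, div_eq_inv_mul, ← tsum_mul_left]
  unfold fourierGauss
  refine tsum_congr fun n => ?_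
  unfold gauss fgTerm bigTheta
  rw [Finset.prod_mul_distrib, ← Complex.exp_sum, ← Finset.mul_sum, ← Complex.ofReal_prod,
    ← Complex.ofReal_prod, ← Real.exp_sum, ← Finset.sum_div, ← Finset.mul_sum]
  push_cast
  simp only [Pi.zero_apply]
  ring

/-- Refined estimate at the origin: for each `D > 0` there is `C_D > 0`, independent of the
dimension `d`, with `|F_{ℤ^d} g_t(ξ) - 1| ≤ C_D e^{-π/t} |ξ|²` for all `d ∈ ℤ_+`, `ξ ∈ 𝕋^d`
and `0 < t ≤ D`. -/
theorem fourier_gauss_origin_refined (D : ℝ) (hD : 0 < D) :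
    ∃ C : ℝ, 0 < C ∧ ∀ d : ℕ, 0 < d → ∀ ξ : Fin d → ℝ,
      (∀ j, ξ j ∈ Set.Ico (-(1/2) : ℝ) (1/2)) → ∀ t : ℝ, 0 < t → t ≤ D →
      ‖fourierGauss d t ξ - 1‖ ≤ C * Real.exp (-π / t) * ∑ j, ξ j ^ 2 := by
  have hK : 0 ≤ fgK D := by
    unfold fgK
    exact mul_nonneg (by positivity) (tsum_nonneg fun k => by positivity)
  refine ⟨fgK D + 1, by linarith, ?_⟩
  intro d _ ξ _ t ht htD
  have hA := fg_one_le ht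
  have hA0 : (theta (1 / t) 0 : ℂ) ≠ 0 := by
    exact_mod_cast (by linarith : theta (1 / t) 0 ≠ 0)
  have hnA : ‖(theta (1 / t) 0 : ℂ)‖ = theta (1 / t) 0 := by
    rw [Complex.norm_real, Real.norm_eq_abs, abs_of_pos (by linarith)]
  rw [fg_eq d ht ξ, Finset.mul_sum]
  refine (fg_prod_sub _ _ fun j => ?_).trans (Finset.sum_le_sum fun j _ => ?_)
  · rw [norm_div, hnA, div_le_one (by linarith)]
    exact fg_norm_sum ht _
  · rw [div_sub_one hA0, norm_div, hnA]
    refine (div_le_self (norm_nonneg _) hA).trans ((fg_sub ht htD _).trans ?_)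
    gcongr
    linarith
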